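/- Theorem (linearly factoring weights, constant vertical weight: Toeplitz matrices along rays). Under the linear factorization hypothesis on the weights, assume in addition that b n = γ for all n, where γ is a nonnegative polynomial, and that t ≥ 1. Let n, k, δ, σ ∈ ℕ with k ≤ n, 1 ≤ δ, k < σ and δ < σ. Then the Toeplitz matrix 𝒯(s) of the sequence s i = M (n + δ·i) (k + σ·i) is totally positive. -/

import Mathlib

open Finset

/-- A multivariate polynomial with real coefficients is *nonnegative* if all of
its coefficients are nonnegative. -/
def PolyNonneg {σ : Type*} (p : MvPolynomial σ ℝ) : Prop :=
  ∀ m, 0 ≤ p.coeff m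

/-- An `ℕ × ℕ` matrix with entries in `MvPolynomial σ ℝ` is *totally positive*
if every minor (taken along strictly increasing row and column indices) is a
nonnegative polynomial. -/
def TP {σ : Type*} (A : ℕ → ℕ → MvPolynomial σ ℝ) : Prop :=
  ∀ r : ℕ, 1 ≤ r → ∀ ρ κ : Fin r → ℕ, StrictMono ρ → StrictMono κ →
    PolyNonneg (Matrix.of fun i j : Fin r => A (ρ i) (κ j)).det

/-- The weighted lattice-path matrix `M`:
`M n 0 = ∏_{i=1}^n b i`, `M n k = 0` for `k ≥ 1` and `n < t`, and
`M n k = Σ_{i=0}^{ℓ} (a n i) * M (n-t-i) (k-1) + (b n) * M (n-1) k`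
for `n ≥ t`, `k ≥ 1`, where summands with a negative first index vanish. -/
def latticeM {R : Type*} [CommRing R] (t ℓ : ℕ) (a : ℕ → ℕ → R) (b : ℕ → R) :
    ℕ → ℕ → R
  | n, 0 => ∏ i ∈ Finset.Icc 1 n, b i
  | 0, k + 1 => if t = 0 then a 0 0 * latticeM t ℓ a b 0 k else 0
  | n + 1, k + 1 =>
      if n + 1 < t then 0
      else (∑ i ∈ Finset.range (ℓ + 1),
              if t + i ≤ n + 1 then a (n + 1) i * latticeM t ℓ a b (n + 1 - t - i) k
              else 0)
        + b (n + 1) * latticeM t ℓ a b n (k + 1)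
  termination_by n k => (k, n)

/-- The Toeplitz matrix of a sequence: `𝒯(c) i j = c (i - j)` for `i ≥ j`
and `0` otherwise. -/
def toeplitz {R : Type*} [CommRing R] (c : ℕ → R) : ℕ → ℕ → R :=
  fun i j => if j ≤ i then c (i - j) else 0

/-- The coefficient of a power series at an integer exponent, zero at negative exponents. -/
noncomputable def intCoeff {R : Type*} [CommRing R] (q : ℤ) : PowerSeries R →ₗ[R] R :=
  if 0 ≤ q then PowerSeries.coeff q.toNat else 0

section IntCoeff

open PowerSeries

variable {R : Type*} [CommRing R]

lemma intCoeff_of_neg {q : ℤ} (hq : q < 0) (f : R⟦X⟧) : intCoeff q f = 0 := by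
  simp [intCoeff, not_le.mpr hq]

lemma intCoeff_natCast (d : ℕ) (f : R⟦X⟧) : intCoeff (d : ℤ) f = coeff d f := by
  simp [intCoeff]

lemma intCoeff_C_mul (c : R) (f : R⟦X⟧) (q : ℤ) :
    intCoeff q (C c * f) = c * intCoeff q f := by
  rw [← smul_eq_C_mul, map_smul, smul_eq_mul]

lemma intCoeff_one (q : ℤ) : intCoeff q (1 : R⟦X⟧) = if q = 0 then 1 else 0 := by
  rcases lt_or_ge q 0 with hq | hq
  · rw [intCoeff_of_neg hq, if_neg hq.ne]
  · lift q to ℕ using hq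
    simp [intCoeff_natCast, coeff_one]

lemma intCoeff_X_pow_mul (i : ℕ) (f : R⟦X⟧) (q : ℤ) :
    intCoeff q (X ^ i * f) = intCoeff (q - i) f := by
  rcases lt_or_ge q 0 with hq | hq
  · rw [intCoeff_of_neg hq, intCoeff_of_neg (by omega)]
  · lift q to ℕ using hq
    rw [intCoeff_natCast, coeff_X_pow_mul']
    split_ifs with h
    · rw [← intCoeff_natCast, Nat.cast_sub h]
    · rw [intCoeff_of_neg (by omega)]

lemma intCoeff_linear_mul (c d : R) (f : R⟦X⟧) (q : ℤ) :
    intCoeff q ((C c + C d * X) * f) = c * intCoeff q f + d * intCoeff (q - 1) f := by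
  have h := intCoeff_X_pow_mul 1 f q
  rw [pow_one, Nat.cast_one] at h
  rw [add_mul, mul_assoc, map_add, intCoeff_C_mul, intCoeff_C_mul, h]

/-- The geometric series `∑ γ ^ n X ^ n`. -/
noncomputable def geomSeries (γ : R) : R⟦X⟧ := PowerSeries.mk fun n => γ ^ n

lemma geomSeries_eq (γ : R) : geomSeries γ = 1 + C γ * X * geomSeries γ := by
  ext n
  cases n with
  | zero => simp [geomSeries]
  | succ n => simp [geomSeries, mul_assoc, coeff_succ_X_mul, coeff_one, pow_succ']

lemma intCoeff_geomSeries_mul (γ : R) (f : R⟦X⟧) (q : ℤ) :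
    intCoeff q (geomSeries γ * f) =
      intCoeff q f + γ * intCoeff (q - 1) (geomSeries γ * f) := by
  have h : geomSeries γ * f = f + (C 0 + C γ * X) * (geomSeries γ * f) := by
    conv_lhs => rw [geomSeries_eq]
    rw [map_zero]
    ring
  conv_lhs => rw [h, map_add, intCoeff_linear_mul, zero_mul, zero_add]

/-- The product of the linear factors `β j + α j X`. -/
noncomputable def linProd {ℓ : ℕ} (α β : Fin ℓ → R) : R⟦X⟧ :=
  ∏ j, (C (β j) + C (α j) * X)

lemma linProd_eq_sum {ℓ : ℕ} (α β : Fin ℓ → R) :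
    linProd α β = ∑ i ∈ Finset.range (ℓ + 1),
      C (∑ S ∈ Finset.powersetCard i (Finset.univ : Finset (Fin ℓ)),
        (∏ j ∈ S, α j) * ∏ j ∈ Sᶜ, β j) * X ^ i := by
  simp_rw [linProd, add_comm (C (β _))]
  rw [Finset.prod_add, Finset.sum_powerset, Finset.card_univ, Fintype.card_fin]
  refine Finset.sum_congr rfl fun i _ => ?_
  rw [map_sum, Finset.sum_mul]
  refine Finset.sum_congr rfl fun S hS => ?_
  rw [Finset.prod_mul_distrib, Finset.prod_const, (Finset.mem_powersetCard.mp hS).2,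
    ← Finset.compl_eq_univ_sdiff, map_mul, map_prod, map_prod]
  ring

lemma intCoeff_linProd_mul {ℓ : ℕ} (α β : Fin ℓ → R) (f : R⟦X⟧) (q : ℤ) :
    intCoeff q (linProd α β * f) = ∑ i ∈ Finset.range (ℓ + 1),
      (∑ S ∈ Finset.powersetCard i (Finset.univ : Finset (Fin ℓ)),
        (∏ j ∈ S, α j) * ∏ j ∈ Sᶜ, β j) * intCoeff (q - i) f := by
  rw [linProd_eq_sum, Finset.sum_mul, map_sum]
  simp_rw [mul_assoc (C _), intCoeff_C_mul, intCoeff_X_pow_mul]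

/-- Columns of the lattice-path matrix with linearly factoring weights and constant vertical
weight are coefficients of explicit power series. -/
lemma latticeM_eq_intCoeff {t ℓ : ℕ} (ht : 1 ≤ t) {a : ℕ → ℕ → R} {b : ℕ → R} {γ : R}
    (hbγ : ∀ n, b n = γ) (α β : Fin ℓ → R)
    (hfact : ∀ n i, i ≤ ℓ → a n i =
      ∑ S ∈ Finset.powersetCard i (Finset.univ : Finset (Fin ℓ)),
        (∏ j ∈ S, α j) * ∏ j ∈ Sᶜ, β j) (k : ℕ) :
    ∀ n : ℕ, latticeM t ℓ a b n k =
      intCoeff ((n : ℤ) - t * k) (linProd α β ^ k * geomSeries γ ^ (k + 1)) := by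
  induction k with
  | zero =>
    intro n
    simp [latticeM, hbγ, intCoeff_natCast, geomSeries]
  | succ k ihk =>
    have hneg : ∀ n : ℕ, n < t → (n : ℤ) - t * ((k + 1 : ℕ) : ℤ) < 0 := by
      intro n hn
      have : (0 : ℤ) ≤ t * k := by positivity
      push_cast
      linarith [(Nat.cast_lt (α := ℤ)).mpr hn]
    intro n
    induction n with
    | zero =>
      rw [latticeM, if_neg (by omega), intCoeff_of_neg (hneg 0 ht)]
    | succ n ihn =>
      rw [latticeM]
      split_ifs with h
      · rw [intCoeff_of_neg (hneg _ h)]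
      · have hsplit : linProd α β ^ (k + 1) * geomSeries γ ^ (k + 1 + 1) =
            geomSeries γ * (linProd α β * (linProd α β ^ k * geomSeries γ ^ (k + 1))) := by ring
        rw [hbγ, ihn]
        conv_rhs => rw [hsplit, intCoeff_geomSeries_mul, ← hsplit]
        congr 1
        · rw [intCoeff_linProd_mul]
          refine Finset.sum_congr rfl fun i hi => ?_
          rw [← hfact (n + 1) i (by simpa [Nat.lt_succ_iff] using hi)]
          split_ifs with hti
          · rw [ihk]
            congr 3
            rw [Nat.sub_sub, Nat.cast_sub hti]
            push_cast
            ring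
          · rw [intCoeff_of_neg, mul_zero]
            have : (0 : ℤ) ≤ t * k := by positivity
            push_cast
            have : (n : ℤ) + 1 < t + i := by exact_mod_cast not_le.mp hti
            linarith
        · congr 3
          push_cast
          ring

end IntCoeff

section Nonneg

variable {τ : Type*} {p q : MvPolynomial τ ℝ}

lemma PolyNonneg.zero : PolyNonneg (0 : MvPolynomial τ ℝ) := fun m => by simp

lemma PolyNonneg.one : PolyNonneg (1 : MvPolynomial τ ℝ) := fun m => by
  classical
  rw [MvPolynomial.coeff_one]
  split_ifs <;> norm_num

lemma PolyNonneg.add (hp : PolyNonneg p) (hq : PolyNonneg q) : PolyNonneg (p + q) :=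
  fun m => by
    rw [MvPolynomial.coeff_add]
    exact add_nonneg (hp m) (hq m)

lemma PolyNonneg.mul (hp : PolyNonneg p) (hq : PolyNonneg q) : PolyNonneg (p * q) :=
  fun m => by
    classical
    rw [MvPolynomial.coeff_mul]
    exact Finset.sum_nonneg fun x _ => mul_nonneg (hp _) (hq _)

lemma PolyNonneg.sum {ι : Type*} {s : Finset ι} {f : ι → MvPolynomial τ ℝ}
    (h : ∀ i ∈ s, PolyNonneg (f i)) : PolyNonneg (∑ i ∈ s, f i) :=
  Finset.sum_induction f PolyNonneg (fun _ _ => PolyNonneg.add) PolyNonneg.zero h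

lemma PolyNonneg.prod {ι : Type*} {s : Finset ι} {f : ι → MvPolynomial τ ℝ}
    (h : ∀ i ∈ s, PolyNonneg (f i)) : PolyNonneg (∏ i ∈ s, f i) :=
  Finset.prod_induction f PolyNonneg (fun _ _ => PolyNonneg.mul) PolyNonneg.one h

end Nonneg

/-- Total positivity of a matrix with rows indexed by `ℤ`, in increasing order, and columns
indexed by `ℕ`, in decreasing order. -/
def AntiTP {τ : Type*} (A : ℤ → ℕ → MvPolynomial τ ℝ) : Prop :=
  ∀ r : ℕ, ∀ ρ : Fin r → ℤ, ∀ κ : Fin r → ℕ, StrictMono ρ → StrictAnti κ →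
    PolyNonneg (Matrix.of fun i j : Fin r => A (ρ i) (κ j)).det

namespace AntiTP

variable {τ : Type*} {A A' : ℤ → ℕ → MvPolynomial τ ℝ}

lemma zero : AntiTP (fun _ _ => (0 : MvPolynomial τ ℝ)) := by
  intro r ρ κ _ _
  cases r with
  | zero => simpa using PolyNonneg.one
  | succ r =>
    rw [Matrix.det_eq_zero_of_row_eq_zero 0 fun _ => rfl]
    exact PolyNonneg.zero

/-- Replacing every row by a nonnegative combination of itself and its predecessor preserves
total positivity. -/
lemma linear (hA : AntiTP A) {c d : ℤ → MvPolynomial τ ℝ}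
    (hc : ∀ q, PolyNonneg (c q)) (hd : ∀ q, PolyNonneg (d q))
    (h : ∀ q j, A' q j = c q * A q j + d q * A (q - 1) j) : AntiTP A' := by
  intro r ρ κ hρ hκ
  have hdet : (Matrix.of fun i j : Fin r => A' (ρ i) (κ j)).det =
      ∑ s : Finset (Fin r), (∏ i, if i ∈ s then c (ρ i) else d (ρ i)) *
        (Matrix.of fun i j : Fin r =>
          A (if i ∈ s then ρ i else ρ i - 1) (κ j)).det := by
    have hadd := (Matrix.detRowAlternating (n := Fin r)
        (R := MvPolynomial τ ℝ)).map_add_univ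
      (fun i j => c (ρ i) * A (ρ i) (κ j)) (fun i j => d (ρ i) * A (ρ i - 1) (κ j))
    have hrows : (Matrix.of fun i j : Fin r => A' (ρ i) (κ j)) =
        ((fun i j => c (ρ i) * A (ρ i) (κ j)) + fun i j => d (ρ i) * A (ρ i - 1) (κ j)) := by
      ext1 i j
      exact h _ _
    rw [hrows]
    refine hadd.trans (Finset.sum_congr rfl fun s _ => ?_)
    rw [← Matrix.det_mul_column]
    refine congrArg Matrix.det ?_
    ext1 i j
    by_cases hi : i ∈ s <;> simp [Finset.piecewise, hi]
  rw [hdet]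
  refine PolyNonneg.sum fun s _ => PolyNonneg.mul (PolyNonneg.prod fun i _ => ?_) ?_
  · split_ifs
    exacts [hc _, hd _]
  · have hmono : Monotone fun i => if i ∈ s then ρ i else ρ i - 1 := by
      intro i j hij
      rcases hij.eq_or_lt with rfl | hlt
      · exact le_rfl
      · have := hρ hlt
        dsimp only
        split_ifs <;> omega
    by_cases hinj : Function.Injective fun i => if i ∈ s then ρ i else ρ i - 1
    · exact hA r _ κ (hmono.strictMono_of_injective hinj) hκ
    · rw [Function.Injective] at hinj
      push Not at hinj
      obtain ⟨i, j, hij, hne⟩ := hinj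
      rw [Matrix.det_zero_of_row_eq hne]
      · exact PolyNonneg.zero
      · ext1 x
        exact congrArg (fun y => A y (κ x)) hij

/-- Total positivity is preserved by the inverse of `row q ↦ row q - c q * row (q - 1)`. -/
lemma geometric (hA : AntiTP A) {c : ℤ → MvPolynomial τ ℝ} (hc : ∀ q, PolyNonneg (c q))
    (h : ∀ q j, A' q j = A q j + c q * A' (q - 1) j)
    (L : ℤ) (hL : ∀ q j, q ≤ L → A' q j = A q j) : AntiTP A' := by
  have hybrid : ∀ d : ℕ, AntiTP fun q j => if q ≤ L + d then A' q j else A q j := by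
    intro d
    induction d with
    | zero =>
      convert hA using 3 with q j
      split_ifs with hq
      · exact hL _ _ (by simpa using hq)
      · rfl
    | succ d ih =>
      refine ih.linear (c := fun _ => 1) (d := fun q => if q = L + d + 1 then c q else 0)
        (fun _ => PolyNonneg.one) (fun q => ?_) fun q j => ?_
      · split_ifs
        exacts [hc q, PolyNonneg.zero]
      · push_cast
        rcases lt_trichotomy q (L + d + 1) with hq | hq | hq
        · rw [if_pos (by omega), if_pos (by omega), if_neg (by omega)]
          ring
        · rw [if_pos (by omega), if_neg (by omega), if_pos hq, if_pos (by omega), h, one_mul]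
        · rw [if_neg (by omega), if_neg (by omega), if_neg (by omega)]
          ring
  intro r ρ κ hρ hκ
  have hbound : ∀ i, ρ i ≤ L + (∑ i, (ρ i - L).toNat : ℕ) := by
    intro i
    have := Finset.single_le_sum (f := fun i => (ρ i - L).toNat) (fun _ _ => Nat.zero_le _)
      (Finset.mem_univ i)
    omega
  simpa only [if_pos (hbound _)] using hybrid (∑ i, (ρ i - L).toNat) r ρ κ hρ hκ

/-- Adjoining a column with a single nonnegative entry to the left of and above all nonzero
entries preserves total positivity. -/
lemma adjoin (hA : AntiTP A) (q₀ : ℤ) (j₀ : ℕ) (hq₀ : PolyNonneg (A' q₀ j₀))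
    (hcol : ∀ q, q ≠ q₀ → A' q j₀ = 0) (hleft : ∀ q j, j₀ < j → A' q j = 0)
    (hrow : ∀ q j, q ≤ q₀ → j < j₀ → A' q j = 0)
    (h : ∀ q j, j < j₀ → A' q j = A q j) : AntiTP A' := by
  intro r ρ κ hρ hκ
  cases r with
  | zero => simpa using PolyNonneg.one
  | succ r =>
    rcases lt_trichotomy (κ 0) j₀ with h0 | h0 | h0
    · have hlt : ∀ j, κ j < j₀ := fun j => (hκ.antitone (Fin.zero_le j)).trans_lt h0
      simp_rw [h _ _ (hlt _)]
      exact hA _ ρ κ hρ hκ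
    · have hlt : ∀ j : Fin r, κ j.succ < j₀ := fun j => h0 ▸ hκ (Fin.succ_pos j)
      rw [Matrix.det_succ_column_zero, Fin.sum_univ_succ, Finset.sum_eq_zero, add_zero]
      · simp only [Fin.val_zero, pow_zero, one_mul, Fin.succAbove_zero]
        refine PolyNonneg.mul ?_ ?_
        · simp only [Matrix.of_apply, h0]
          by_cases hq : ρ 0 = q₀
          · rwa [hq]
          · rw [hcol _ hq]
            exact PolyNonneg.zero
        · have := hA r (ρ ∘ Fin.succ) (κ ∘ Fin.succ) (hρ.comp (Fin.strictMono_succ))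
            (hκ.comp_strictMono (Fin.strictMono_succ))
          convert this using 2
          ext1 i j
          exact h _ _ (hlt j)
      · intro i _
        by_cases hq : ρ i.succ = q₀
        · have : NeZero r := ⟨fun hr => (hr ▸ i).elim0⟩
          rw [Matrix.det_eq_zero_of_row_eq_zero (0 : Fin r), mul_zero]
          intro j
          refine hrow _ _ ?_ (hlt j)
          rw [Fin.succ_succAbove_zero, ← hq]
          exact (hρ (Fin.succ_pos i)).le
        · simp [h0, hcol _ hq]
    · rw [Matrix.det_eq_zero_of_column_eq_zero (0 : Fin (r + 1)) fun i => hleft _ _ h0]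
      exact PolyNonneg.zero

end AntiTP

section Levels

open PowerSeries

variable {τ : Type*} {m : ℕ} {φ : ℤ → ℕ} {B : ℤ → ℕ → MvPolynomial τ ℝ} {h : ℕ}
  {g : ℕ → (MvPolynomial τ ℝ)⟦X⟧}

/-- The matrix whose column `j` holds the coefficients of `g j`, shifted by `m * j`, except that
rows `q` with `φ q < h` are those of `B`. -/
noncomputable def frozenMatrix (m : ℕ) (φ : ℤ → ℕ) (B : ℤ → ℕ → MvPolynomial τ ℝ) (h : ℕ)
    (g : ℕ → (MvPolynomial τ ℝ)⟦X⟧) (q : ℤ) (j : ℕ) : MvPolynomial τ ℝ :=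
  if h ≤ φ q then intCoeff (q + m * j) (g j) else B q j

lemma frozenMatrix_linear_mul (hφ : Antitone φ) (hg : AntiTP (frozenMatrix m φ B h g))
    {c d : MvPolynomial τ ℝ} (hc : PolyNonneg c) (hd : PolyNonneg d) :
    AntiTP (frozenMatrix m φ B h fun j => (C c + C d * X) * g j) := by
  refine hg.linear (c := fun q => if h ≤ φ q then c else 1)
    (d := fun q => if h ≤ φ q then d else 0) (fun q => ?_) (fun q => ?_) fun q j => ?_
  · split_ifs
    exacts [hc, PolyNonneg.one]
  · split_ifs
    exacts [hd, PolyNonneg.zero]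
  · by_cases hq : h ≤ φ q
    · have hq' : h ≤ φ (q - 1) := hq.trans (hφ (by omega))
      simp only [frozenMatrix, if_pos hq, if_pos hq', intCoeff_linear_mul, add_sub_right_comm]
    · simp [frozenMatrix, hq]

lemma frozenMatrix_linProd_mul (hφ : Antitone φ) (hg : AntiTP (frozenMatrix m φ B h g))
    {ℓ : ℕ} {α β : Fin ℓ → MvPolynomial τ ℝ}
    (hα : ∀ j, PolyNonneg (α j)) (hβ : ∀ j, PolyNonneg (β j)) :
    AntiTP (frozenMatrix m φ B h fun j => linProd α β * g j) := by
  have key : ∀ s : Finset (Fin ℓ), AntiTP (frozenMatrix m φ B h fun j =>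
      (∏ i ∈ s, (C (β i) + C (α i) * X)) * g j) := by
    intro s
    induction s using Finset.induction_on with
    | empty => simpa using hg
    | insert i s hi ih =>
      simpa only [Finset.prod_insert hi, mul_assoc] using
        frozenMatrix_linear_mul hφ ih (hβ i) (hα i)
  exact key Finset.univ

lemma frozenMatrix_geomSeries_mul (hφ : Antitone φ) (hg : AntiTP (frozenMatrix m φ B h g))
    {γ : MvPolynomial τ ℝ} (hγ : PolyNonneg γ) (J : ℕ) (hJ : ∀ j, J < j → g j = 0) :
    AntiTP (frozenMatrix m φ B h fun j => geomSeries γ * g j) := by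
  refine hg.geometric (c := fun q => if h ≤ φ q then γ else 0) (fun q => ?_) (fun q j => ?_)
    (-(m * J) - 1) fun q j hq => ?_
  · split_ifs
    exacts [hγ, PolyNonneg.zero]
  · by_cases hq : h ≤ φ q
    · have hq' : h ≤ φ (q - 1) := hq.trans (hφ (by omega))
      simp only [frozenMatrix, if_pos hq, if_pos hq']
      rw [intCoeff_geomSeries_mul, add_sub_right_comm]
    · simp [frozenMatrix, hq]
  · rcases lt_or_ge J j with hj | hj
    · simp [frozenMatrix, hJ j hj]
    · have : (m : ℤ) * j ≤ m * J := by gcongr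
      simp only [frozenMatrix]
      rw [intCoeff_of_neg (by omega), intCoeff_of_neg (by omega)]

lemma frozenMatrix_update_one (hm : 0 < m) (hg : AntiTP (frozenMatrix m φ B h g)) (j₀ : ℕ)
    (hzero : ∀ j, j₀ ≤ j → g j = 0) (hB : ∀ q j, φ q < h → j₀ ≤ j → B q j = 0)
    (hB' : ∀ (q : ℤ) (j : ℕ), q + m * j < 0 → B q j = 0) :
    AntiTP (frozenMatrix m φ B h (Function.update g j₀ 1)) := by
  refine hg.adjoin (-(m * j₀)) j₀ ?_ (fun q hq => ?_) (fun q j hj => ?_) (fun q j hq hj => ?_)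
    fun q j hj => ?_
  · simp only [frozenMatrix, Function.update_self]
    split_ifs with hq
    · rw [intCoeff_one]
      split_ifs
      exacts [PolyNonneg.one, PolyNonneg.zero]
    · rw [hB _ _ (not_le.mp hq) le_rfl]
      exact PolyNonneg.zero
  · simp only [frozenMatrix, Function.update_self]
    split_ifs with hq'
    · rw [intCoeff_one, if_neg (by omega)]
    · exact hB _ _ (not_le.mp hq') le_rfl
  · simp only [frozenMatrix, Function.update_of_ne hj.ne', hzero j hj.le, map_zero]
    split_ifs with hq'
    · rfl
    · exact hB _ _ (not_le.mp hq') hj.le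
  · have hlt : (m : ℤ) * j < m * j₀ := by gcongr
    have hneg : q + m * j < 0 := by omega
    simp [frozenMatrix, intCoeff_of_neg hneg, hB' q j hneg]
  · simp only [frozenMatrix, Function.update_of_ne hj.ne]

/-- The generating function, after `h` levels, of paths starting at level `s`. -/
noncomputable def levelSeries (P F : (MvPolynomial τ ℝ)⟦X⟧) (s h : ℕ) : (MvPolynomial τ ℝ)⟦X⟧ :=
  if s ≤ h then P ^ (h - s) * F ^ (h - s + 1) else 0

/-- The matrix whose column `j` records weighted paths starting at level `σ * j` and position
`-(m * j)`, and whose row `q` is read off at level `φ q`, is totally positive. -/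
theorem antiTP_levelSeries {ℓ σ : ℕ} {α β : Fin ℓ → MvPolynomial τ ℝ} {γ : MvPolynomial τ ℝ}
    (hα : ∀ j, PolyNonneg (α j)) (hβ : ∀ j, PolyNonneg (β j)) (hγ : PolyNonneg γ)
    (hm : 0 < m) (hσ : 0 < σ) (hφ : Antitone φ) :
    AntiTP fun q j =>
      intCoeff (q + m * j) (levelSeries (linProd α β) (geomSeries γ) (σ * j) (φ q)) := by
  set P := linProd α β with hP
  set F := geomSeries γ
  set B : ℤ → ℕ → MvPolynomial τ ℝ := fun q j =>
    intCoeff (q + m * j) (levelSeries P F (σ * j) (φ q)) with hBdef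
  have levels : ∀ h, AntiTP (frozenMatrix m φ B h fun j =>
      if σ * j < h then P ^ (h - σ * j) * F ^ (h - σ * j) else 0) := by
    intro h
    induction h with
    | zero =>
      convert AntiTP.zero (τ := τ) using 3 with q j
      simp [frozenMatrix]
    | succ h ih =>
      have source : AntiTP (frozenMatrix m φ B h fun j =>
          if σ * j ≤ h then P ^ (h - σ * j) * F ^ (h - σ * j) else 0) := by
        by_cases hdvd : σ ∣ h
        · obtain ⟨j₀, rfl⟩ := hdvd
          convert frozenMatrix_update_one hm ih j₀ (fun j hj => ?_) (fun q j hq hj => ?_)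
            (fun q j hq => ?_) using 2
          · ext1 j
            rcases eq_or_ne j j₀ with rfl | hj
            · simp
            · have hne : σ * j ≠ σ * j₀ := fun h => hj (Nat.eq_of_mul_eq_mul_left hσ h)
              simp only [Function.update_of_ne hj, hne.le_iff_lt]
          · rw [if_neg (not_lt.mpr (Nat.mul_le_mul_left σ hj))]
          · have := Nat.mul_le_mul_left σ hj
            simp [hBdef, levelSeries, show ¬ σ * j ≤ φ q by omega]
          · exact intCoeff_of_neg hq _
        · convert ih using 4 with j
          exact (Ne.le_iff_lt fun h' => hdvd ⟨j, h'.symm⟩)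
      have vertical : AntiTP (frozenMatrix m φ B h fun j => levelSeries P F (σ * j) h) := by
        convert frozenMatrix_geomSeries_mul hφ source hγ h fun j hj => ?_ using 2
        · ext1 j
          rw [levelSeries]
          split_ifs
          · ring
          · simp
        · rw [if_neg]
          have := Nat.le_mul_of_pos_left j hσ
          omega
      have freeze : frozenMatrix m φ B h (fun j => levelSeries P F (σ * j) h) =
          frozenMatrix m φ B (h + 1) fun j => levelSeries P F (σ * j) h := by
        ext1 q
        ext1 j
        simp only [frozenMatrix]
        rcases lt_trichotomy (φ q) h with hq | hq | hq
        · rw [if_neg (by omega), if_neg (by omega)]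
        · rw [if_pos hq.ge, if_neg (by omega)]
          simp only [hBdef, hq]
        · rw [if_pos hq.le, if_pos (by omega)]
      rw [freeze] at vertical
      convert frozenMatrix_linProd_mul hφ vertical hα hβ using 2
      ext1 j
      simp only [levelSeries, Nat.lt_succ_iff]
      split_ifs with hj
      · rw [Nat.succ_sub hj, Nat.succ_eq_add_one, ← hP]
        ring
      · simp
  intro r ρ κ hρ hκ
  have hbound : ∀ i, ¬ (∑ i, φ (ρ i)) + 1 ≤ φ (ρ i) := by
    intro i
    have := Finset.single_le_sum (f := fun i => φ (ρ i)) (fun _ _ => Nat.zero_le _)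
      (Finset.mem_univ i)
    omega
  simpa only [frozenMatrix, if_neg (hbound _)] using
    levels ((∑ i, φ (ρ i)) + 1) r ρ κ hρ hκ

end Levels

/-- **Theorem (linearly factoring weights, constant vertical weight: Toeplitz
matrices along rays).**  Under the linear factorization hypothesis on the
weights, if `b n = γ` for all `n` with `γ` a nonnegative polynomial, `t ≥ 1`,
`k ≤ n`, `1 ≤ δ`, `k < σ` and `δ < σ`, then the Toeplitz matrix of the
sequence `i ↦ M (n + δ·i) (k + σ·i)` is totally positive. -/
theorem toeplitz_ray_latticeM_totallyPositive_of_linear_factorization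
    {σ₀ : Type*} (t ℓ : ℕ) (ht : 1 ≤ t)
    (a : ℕ → ℕ → MvPolynomial σ₀ ℝ) (b : ℕ → MvPolynomial σ₀ ℝ)
    (γ : MvPolynomial σ₀ ℝ) (hγ : PolyNonneg γ) (hbγ : ∀ n, b n = γ)
    (α β : Fin ℓ → MvPolynomial σ₀ ℝ)
    (hα : ∀ j, PolyNonneg (α j)) (hβ : ∀ j, PolyNonneg (β j))
    (hfact : ∀ n i, i ≤ ℓ → a n i =
      ∑ S ∈ Finset.powersetCard i (Finset.univ : Finset (Fin ℓ)),
        (∏ j ∈ S, α j) * ∏ j ∈ Sᶜ, β j)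
    (n k δ σ : ℕ) (hkn : k ≤ n) (hδ : 1 ≤ δ) (hkσ : k < σ) (hδσ : δ < σ) :
    TP (toeplitz fun i => latticeM t ℓ a b (n + δ * i) (k + σ * i)) := by
  obtain ⟨m, hm⟩ : ∃ m, t * σ = δ + m :=
    Nat.exists_eq_add_of_le (hδσ.le.trans (Nat.le_mul_of_pos_left σ ht))
  have hm0 : 0 < m := by
    have := Nat.le_mul_of_pos_left σ ht
    omega
  have hmZ : (t : ℤ) * σ = δ + m := by exact_mod_cast hm
  set N : ℤ := n - t * k with hN
  have hφ : Antitone fun q : ℤ => k + σ * ((N - q) / m).toNat := by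
    intro q q' hq
    have : (N - q') / m ≤ (N - q) / m := Int.ediv_le_ediv (by exact_mod_cast hm0) (by omega)
    dsimp only
    have := Int.toNat_le_toNat this
    gcongr
  have hTP := antiTP_levelSeries hα hβ hγ hm0 (by omega : 0 < σ) hφ
  have hentry : ∀ i j : ℕ,
      toeplitz (fun i => latticeM t ℓ a b (n + δ * i) (k + σ * i)) i j =
        intCoeff (N - m * i + m * j) (levelSeries (linProd α β) (geomSeries γ) (σ * j)
          (k + σ * ((N - (N - m * i)) / m).toNat)) := by
    intro i j
    have hdiv : ((N - (N - m * i)) / m).toNat = i := by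
      rw [sub_sub_cancel, Int.mul_ediv_cancel_left _ (by omega), Int.toNat_natCast]
    rw [hdiv, toeplitz, levelSeries]
    by_cases hij : j ≤ i
    · obtain ⟨d, rfl⟩ := Nat.exists_eq_add_of_le hij
      have hsub : k + σ * (j + d) - σ * j = k + σ * d := by
        rw [mul_add]
        omega
      rw [if_pos hij, if_pos (by rw [mul_add]; omega), hsub, Nat.add_sub_cancel_left,
        latticeM_eq_intCoeff ht hbγ α β hfact]
      congr 1
      push_cast
      congr 1
      linear_combination (-(d : ℤ)) * hmZ
    · have : σ * (i + 1) ≤ σ * j := Nat.mul_le_mul_left σ (by omega)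
      rw [mul_add] at this
      rw [if_neg hij, if_neg (by omega), map_zero]
  intro r _ ρ κ hρ hκ
  have hrows : StrictMono fun i : Fin r => N - m * ρ (Fin.rev i) := by
    intro i i' hi
    have : (m : ℤ) * ρ (Fin.rev i') < m * ρ (Fin.rev i) := by
      gcongr
      exact hρ (Fin.rev_lt_rev.mpr hi)
    dsimp only
    omega
  have hcols : StrictAnti fun j : Fin r => κ (Fin.rev j) :=
    fun j j' hj => hκ (Fin.rev_lt_rev.mpr hj)
  rw [← Matrix.det_submatrix_equiv_self Fin.revPerm]
  convert hTP r _ _ hrows hcols using 2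
  ext1 i j
  exact hentry _ _
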